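/- On the polynomial ring ℚ[x₁,x₂,x₃], the derivations R₂ = (1/8)(x₁² − x₂²)·∂/∂x₁ + (1/4)(x₁x₂ − x₃)·∂/∂x₂ + (1/2)(x₁x₃ − x₂³)·∂/∂x₃, H = 2x₁·∂/∂x₁ + 2x₂·∂/∂x₂ + 4x₃·∂/∂x₃, and F = −8·∂/∂x₁ satisfy the sl₂ commutation relations ⁅R₂, F⁆ = H, ⁅H, R₂⁆ = 2R₂, and ⁅H, F⁆ = −2F; hence the Lie algebra they generate is isomorphic to sl₂(ℚ). -/

import Mathlib

open MvPolynomial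

/-- The Ramanujan-type vector field `R₂` for `Γ₀(2)`, as a derivation of `ℚ[x₁,x₂,x₃]`. -/
noncomputable def R2 : Derivation ℚ (MvPolynomial (Fin 3) ℚ) (MvPolynomial (Fin 3) ℚ) :=
  MvPolynomial.mkDerivation ℚ
    ![C (1/8 : ℚ) * (X 0 ^ 2 - X 1 ^ 2),
      C (1/4 : ℚ) * (X 0 * X 1 - X 2),
      C (1/2 : ℚ) * (X 0 * X 2 - X 1 ^ 3)]

/-- The weight (Euler-type) vector field `H = 2x₁∂₁ + 2x₂∂₂ + 4x₃∂₃`. -/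
noncomputable def H2 : Derivation ℚ (MvPolynomial (Fin 3) ℚ) (MvPolynomial (Fin 3) ℚ) :=
  MvPolynomial.mkDerivation ℚ ![2 * X 0, 2 * X 1, 4 * X 2]

/-- The vector field `F = -8∂₁`. -/
noncomputable def F2 : Derivation ℚ (MvPolynomial (Fin 3) ℚ) (MvPolynomial (Fin 3) ℚ) :=
  MvPolynomial.mkDerivation ℚ ![-8, 0, 0]

theorem aux_num (D : Derivation ℚ (MvPolynomial (Fin 3) ℚ) (MvPolynomial (Fin 3) ℚ)) :
    D 2 = 0 ∧ D 4 = 0 ∧ D 8 = 0 ∧ D (-8) = 0 := by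
  have h2 : D 2 = 0 := by exact_mod_cast D.map_natCast 2
  have h4 : D 4 = 0 := by exact_mod_cast D.map_natCast 4
  have h8 : D 8 = 0 := by exact_mod_cast D.map_natCast 8
  exact ⟨h2, h4, h8, by rw [map_neg, h8, neg_zero]⟩

theorem aux_C : (C (1/8 : ℚ) : MvPolynomial (Fin 3) ℚ) * 8 = 1 ∧
    (C (1/4 : ℚ) : MvPolynomial (Fin 3) ℚ) * 4 = 1 ∧
    (C (1/2 : ℚ) : MvPolynomial (Fin 3) ℚ) * 2 = 1 := by
  have h8 : (8 : MvPolynomial (Fin 3) ℚ) = C 8 := rfl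
  have h4 : (4 : MvPolynomial (Fin 3) ℚ) = C 4 := rfl
  have h2 : (2 : MvPolynomial (Fin 3) ℚ) = C 2 := rfl
  rw [h8, h4, h2]
  simp only [← C_mul]
  norm_num

theorem R2_X0 : R2 (X 0) = C (1/8 : ℚ) * (X 0 ^ 2 - X 1 ^ 2) := mkDerivation_X _ _ _
theorem R2_X1 : R2 (X 1) = C (1/4 : ℚ) * (X 0 * X 1 - X 2) := mkDerivation_X _ _ _
theorem R2_X2 : R2 (X 2) = C (1/2 : ℚ) * (X 0 * X 2 - X 1 ^ 3) := mkDerivation_X _ _ _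
theorem H2_X0 : H2 (X 0) = 2 * X 0 := mkDerivation_X _ _ _
theorem H2_X1 : H2 (X 1) = 2 * X 1 := mkDerivation_X _ _ _
theorem H2_X2 : H2 (X 2) = 4 * X 2 := mkDerivation_X _ _ _
theorem F2_X0 : F2 (X 0) = -8 := mkDerivation_X _ _ _
theorem F2_X1 : F2 (X 1) = 0 := mkDerivation_X _ _ _
theorem F2_X2 : F2 (X 2) = 0 := mkDerivation_X _ _ _

theorem aux_two (D : Derivation ℚ (MvPolynomial (Fin 3) ℚ) (MvPolynomial (Fin 3) ℚ)) (i : Fin 3) :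
    ((2 : ℚ) • D) (X i) = 2 * D (X i) := by
  rw [Derivation.smul_apply, smul_eq_C_mul]; rfl

theorem aux_neg_two (D : Derivation ℚ (MvPolynomial (Fin 3) ℚ) (MvPolynomial (Fin 3) ℚ))
    (i : Fin 3) : ((-2 : ℚ) • D) (X i) = -2 * D (X i) := by
  rw [Derivation.smul_apply, smul_eq_C_mul, C_neg]; rfl

theorem aux_RF : ⁅R2, F2⁆ = H2 := by
  apply MvPolynomial.derivation_ext
  intro i
  obtain ⟨c8, c4, c2⟩ := aux_C
  obtain ⟨d2, d4, d8, d8'⟩ := aux_num R2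
  fin_cases i <;>
    simp only [Fin.zero_eta, Fin.mk_one, Fin.reduceFinMk, Derivation.commutator_apply, R2_X0, R2_X1,
      R2_X2, H2_X0, H2_X1, H2_X2, F2_X0, F2_X1, F2_X2, Derivation.leibniz, Derivation.leibniz_pow,
      derivation_C, map_sub, map_zero, d8', smul_eq_mul, nsmul_eq_mul, Nat.cast_ofNat]
  · linear_combination 2 * X 0 * c8
  · linear_combination 2 * X 1 * c4
  · linear_combination 4 * X 2 * c2

theorem aux_HR : ⁅H2, R2⁆ = (2 : ℚ) • R2 := by
  apply MvPolynomial.derivation_ext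
  intro i
  obtain ⟨d2, d4, d8, d8'⟩ := aux_num R2
  fin_cases i <;>
    simp only [Fin.zero_eta, Fin.mk_one, Fin.reduceFinMk, aux_two, Derivation.commutator_apply,
      R2_X0, R2_X1, R2_X2, H2_X0, H2_X1, H2_X2, Derivation.leibniz, Derivation.leibniz_pow,
      derivation_C, map_sub, d2, d4, smul_eq_mul, nsmul_eq_mul, Nat.cast_ofNat] <;>
    ring

theorem aux_HF : ⁅H2, F2⁆ = (-2 : ℚ) • F2 := by
  apply MvPolynomial.derivation_ext
  intro i
  obtain ⟨d2, d4, d8, d8'⟩ := aux_num F2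
  obtain ⟨-, -, -, e8⟩ := aux_num H2
  fin_cases i <;>
    simp only [Fin.zero_eta, Fin.mk_one, Fin.reduceFinMk, aux_neg_two, Derivation.commutator_apply,
      F2_X0, F2_X1, F2_X2, H2_X0, H2_X1, H2_X2, Derivation.leibniz,
      map_zero, d2, d4, e8, smul_eq_mul] <;>
    ring

theorem aux_bracket {L : Type*} [LieRing L] [LieAlgebra ℚ L] {R H F : L} (hRF : ⁅R, F⁆ = H)
    (hHR : ⁅H, R⁆ = (2 : ℚ) • R) (hHF : ⁅H, F⁆ = (-2 : ℚ) • F) (a b c a' b' c' : ℚ) :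
    ⁅b • R + a • H + c • F, b' • R + a' • H + c' • F⁆ =
      (2 * (a * b' - b * a')) • R + (b * c' - c * b') • H + (2 * (c * a' - a * c')) • F := by
  have hFR : ⁅F, R⁆ = -H := by rw [← lie_skew, hRF]
  have hRH : ⁅R, H⁆ = -((2 : ℚ) • R) := by rw [← lie_skew, hHR]
  have hFH : ⁅F, H⁆ = -((-2 : ℚ) • F) := by rw [← lie_skew, hHF]
  simp only [lie_add, add_lie, lie_smul, smul_lie, lie_self, hRF, hHR, hHF, hFR, hRH, hFH]
  module

theorem aux_tr (A : LieAlgebra.SpecialLinear.sl (Fin 2) ℚ) : A.1 1 1 = - A.1 0 0 := by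
  have h : Matrix.trace A.1 = 0 := LinearMap.mem_ker.mp A.2
  rw [Matrix.trace_fin_two] at h
  linarith

/-- The representation of `sl₂` by vector fields. -/
noncomputable def auxPhi : LieAlgebra.SpecialLinear.sl (Fin 2) ℚ →ₗ⁅ℚ⁆
    Derivation ℚ (MvPolynomial (Fin 3) ℚ) (MvPolynomial (Fin 3) ℚ) where
  toFun A := A.1 0 1 • R2 + A.1 0 0 • H2 + A.1 1 0 • F2
  map_add' A B := by
    simp only [AddMemClass.coe_add, Matrix.add_apply]
    module
  map_smul' c A := by
    simp only [SetLike.val_smul, Matrix.smul_apply, RingHom.id_apply, smul_eq_mul]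
    module
  map_lie' := by
    intro A B
    refine Eq.trans ?_ (aux_bracket aux_RF aux_HR aux_HF _ _ _ _ _ _).symm
    simp only [LieAlgebra.SpecialLinear.sl_bracket, Matrix.sub_apply, Matrix.mul_apply,
      Fin.sum_univ_two, aux_tr]
    module

theorem auxPhi_apply (A : LieAlgebra.SpecialLinear.sl (Fin 2) ℚ) :
    auxPhi A = A.1 0 1 • R2 + A.1 0 0 • H2 + A.1 1 0 • F2 := rfl

theorem auxPhi_mk (a b c : ℚ) : ∃ A, auxPhi A = b • R2 + a • H2 + c • F2 := by
  refine ⟨⟨!![a, b; c, -a], ?_⟩, ?_⟩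
  · change Matrix.trace (!![a, b; c, -a] : Matrix (Fin 2) (Fin 2) ℚ) = 0
    rw [Matrix.trace_fin_two]
    simp
  · rw [auxPhi_apply]
    simp

theorem aux_indep (a b c : ℚ) (h : b • R2 + a • H2 + c • F2 = 0) : a = 0 ∧ b = 0 ∧ c = 0 := by
  have e0 := DFunLike.congr_fun h (X 0)
  have e1 := DFunLike.congr_fun h (X 1)
  simp only [Derivation.add_apply, Derivation.smul_apply, R2, H2, F2, mkDerivation_X,
    Derivation.zero_apply] at e0 e1
  have k1 := congrArg (MvPolynomial.eval ![0, 0, 1]) e1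
  have k2 := congrArg (MvPolynomial.eval ![0, 1, 0]) e1
  have k3 := congrArg (MvPolynomial.eval ![0, 0, 0]) e0
  simp [smul_eval] at k1 k2 k3
  exact ⟨k2, k1, k3⟩

theorem auxPhi_inj : Function.Injective auxPhi := by
  rw [injective_iff_map_eq_zero]
  intro A hA
  rw [auxPhi_apply] at hA
  obtain ⟨h1, h2, h3⟩ := aux_indep _ _ _ hA
  apply Subtype.ext
  ext i j
  have h4 := aux_tr A
  rw [h1] at h4
  fin_cases i <;> fin_cases j <;> simp [h1, h2, h3, h4]

theorem auxPhi_range : auxPhi.range = LieSubalgebra.lieSpan ℚ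
    (Derivation ℚ (MvPolynomial (Fin 3) ℚ) (MvPolynomial (Fin 3) ℚ)) {R2, H2, F2} := by
  apply le_antisymm
  · rintro _ ⟨A, rfl⟩
    have hs := LieSubalgebra.subset_lieSpan (R := ℚ)
      (L := Derivation ℚ (MvPolynomial (Fin 3) ℚ) (MvPolynomial (Fin 3) ℚ)) (s := {R2, H2, F2})
    have m1 := hs (show R2 ∈ _ by simp)
    have m2 := hs (show H2 ∈ _ by simp)
    have m3 := hs (show F2 ∈ _ by simp)
    exact add_mem (add_mem (LieSubalgebra.smul_mem _ _ m1) (LieSubalgebra.smul_mem _ _ m2))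
      (LieSubalgebra.smul_mem _ _ m3)
  · rw [LieSubalgebra.lieSpan_le]
    rintro D (rfl | rfl | rfl)
    · obtain ⟨A, hA⟩ := auxPhi_mk 0 1 0
      exact ⟨A, hA.trans (by simp)⟩
    · obtain ⟨A, hA⟩ := auxPhi_mk 1 0 0
      exact ⟨A, hA.trans (by simp)⟩
    · obtain ⟨A, hA⟩ := auxPhi_mk 0 0 1
      exact ⟨A, hA.trans (by simp)⟩

theorem sl2_structure_Gamma0_2 :
    ⁅R2, F2⁆ = H2 ∧ ⁅H2, R2⁆ = (2 : ℚ) • R2 ∧ ⁅H2, F2⁆ = (-2 : ℚ) • F2 ∧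
    Nonempty
      ((LieSubalgebra.lieSpan ℚ
          (Derivation ℚ (MvPolynomial (Fin 3) ℚ) (MvPolynomial (Fin 3) ℚ)) {R2, H2, F2}) ≃ₗ⁅ℚ⁆
        LieAlgebra.SpecialLinear.sl (Fin 2) ℚ) := by
  refine ⟨aux_RF, aux_HR, aux_HF, ?_⟩
  rw [← auxPhi_range]
  exact ⟨(LieEquiv.ofInjective auxPhi auxPhi_inj).symm⟩
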